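/- Let u : ℝ → ℝ be continuously differentiable on [0, ∞) with |u(t)| ≤ M e^{k t} and |u'(t)| ≤ M e^{k t} for all t ≥ 0 for some constants M > 0 and k ∈ ℝ, and let 0 < β < 1. Then for every s > max(k, 0), the Aboodh transform of the Caputo fractional derivative of u of order β satisfies A[D^β u](s) = s^β · A[u](s) − u(0)/s^{2−β}, where D^β u = J^{1−β} u'; explicitly, (1/s) ∫₀^∞ e^{−s t} [(1/Γ(1−β)) ∫₀ᵗ (t−κ)^{−β} u'(κ) dκ] dt = s^β · (1/s) ∫₀^∞ u(t) e^{−s t} dt − u(0)/s^{2−β}. -/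

import Mathlib

open MeasureTheory Real Set intervalIntegral

theorem integrableOn_mul_exp_of_abs_le {f : ℝ → ℝ} {M k s : ℝ}
    (hf : ContinuousOn f (Ici 0)) (hb : ∀ t, 0 ≤ t → |f t| ≤ M * exp (k * t)) (hks : k < s) :
    IntegrableOn (fun t => exp (-(s * t)) * f t) (Ioi 0) := by
  have hg : IntegrableOn (fun t => M * exp ((k - s) * t)) (Ioi 0) :=
    (integrableOn_exp_mul_Ioi (by linarith) 0).const_mul M
  refine hg.mono' ?_ ?_
  · exact (ContinuousOn.mul (by fun_prop) (hf.mono Ioi_subset_Ici_self)).aestronglyMeasurable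
      measurableSet_Ioi
  · filter_upwards [ae_restrict_mem measurableSet_Ioi] with t ht
    have h := mul_le_mul_of_nonneg_left (hb t (le_of_lt ht)) (exp_pos (-(s * t))).le
    rw [norm_mul, norm_eq_abs, norm_eq_abs, abs_exp]
    refine h.trans_eq ?_
    rw [mul_left_comm, ← exp_add]
    ring_nf

theorem tendsto_mul_exp_of_abs_le {f : ℝ → ℝ} {M k s : ℝ}
    (hb : ∀ t, 0 ≤ t → |f t| ≤ M * exp (k * t)) (hks : k < s) :
    Filter.Tendsto (fun t => exp (-(s * t)) * f t) Filter.atTop (nhds 0) := by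
  have hg : Filter.Tendsto (fun t => M * exp ((k - s) * t)) Filter.atTop (nhds 0) := by
    have := (tendsto_exp_atBot.comp
      (Filter.tendsto_id.const_mul_atTop_of_neg (sub_neg.2 hks))).const_mul M
    simpa using this
  refine squeeze_zero_norm' ?_ hg
  filter_upwards [Filter.eventually_ge_atTop 0] with t ht
  have h := mul_le_mul_of_nonneg_left (hb t ht) (exp_pos (-(s * t))).le
  rw [norm_mul, norm_eq_abs, norm_eq_abs, abs_exp]
  refine h.trans_eq ?_
  rw [mul_left_comm, ← exp_add]
  ring_nf

theorem integral_exp_mul_derivWithin {u : ℝ → ℝ} (hu : ContDiffOn ℝ 1 u (Ici 0)) {M k s : ℝ}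
    (hbu : ∀ t, 0 ≤ t → |u t| ≤ M * exp (k * t))
    (hbu' : ∀ t, 0 ≤ t → |derivWithin u (Ici 0) t| ≤ M * exp (k * t)) (hks : k < s) :
    ∫ t in Ioi (0 : ℝ), exp (-(s * t)) * derivWithin u (Ici 0) t =
      s * (∫ t in Ioi (0 : ℝ), exp (-(s * t)) * u t) - u 0 := by
  have hI := integrableOn_mul_exp_of_abs_le hu.continuousOn hbu hks
  have hI' := integrableOn_mul_exp_of_abs_le
    (hu.continuousOn_derivWithin (uniqueDiffOn_Ici 0) le_rfl) hbu' hks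
  have hderiv : ∀ t ∈ Ioi (0 : ℝ), HasDerivAt (fun t => exp (-(s * t)) * u t)
      (exp (-(s * t)) * derivWithin u (Ici 0) t - s * (exp (-(s * t)) * u t)) t := by
    intro t ht
    have h1 : HasDerivAt u (derivWithin u (Ici 0) t) t :=
      ((hu.differentiableOn one_ne_zero t (Ioi_subset_Ici_self ht)).hasDerivWithinAt).hasDerivAt
        (Ici_mem_nhds ht)
    have h2 : HasDerivAt (fun t => exp (-(s * t))) (exp (-(s * t)) * (-(s * 1))) t :=
      ((hasDerivAt_id t).const_mul s).neg.exp
    convert! h2.mul h1 using 1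
    ring
  have hc : ContinuousWithinAt (fun t => exp (-(s * t)) * u t) (Ici 0) 0 :=
    ContinuousWithinAt.mul (by fun_prop) (hu.continuousOn 0 self_mem_Ici)
  have h := integral_Ioi_of_hasDerivAt_of_tendsto hc hderiv (hI'.sub (hI.const_mul s))
    (tendsto_mul_exp_of_abs_le hbu hks)
  rw [integral_sub hI' (hI.const_mul s), MeasureTheory.integral_const_mul] at h
  simp only [mul_zero, neg_zero, exp_zero, one_mul] at h
  linarith

/-- The Laplace transform of a convolution with a power kernel. -/
theorem integral_exp_mul_integral_sub_rpow_mul {f : ℝ → ℝ} {β s : ℝ} (hβ : β < 1) (hs : 0 < s)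
    (hf : IntegrableOn (fun t => exp (-(s * t)) * f t) (Ioi 0)) :
    ∫ t in Ioi (0 : ℝ), exp (-(s * t)) * ∫ κ in (0 : ℝ)..t, (t - κ) ^ (-β) * f κ =
      (∫ t in Ioi (0 : ℝ), exp (-(s * t)) * f t) * (Gamma (1 - β) * s ^ (β - 1)) := by
  have hg : IntegrableOn (fun t : ℝ => t ^ (-β) * exp (-(s * t))) (Ioi 0) := by
    simpa using integrableOn_rpow_mul_exp_neg_mul_rpow (p := 1) (s := -β) (by linarith) one_pos hs
  have hG : ∫ t in Ioi (0 : ℝ), t ^ (-β) * exp (-(s * t)) = Gamma (1 - β) * s ^ (β - 1) := by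
    have := integral_rpow_mul_exp_neg_mul_Ioi (a := 1 - β) (r := s) (by linarith) hs
    rw [show 1 - β - 1 = -β by ring] at this
    rw [this, one_div, inv_rpow hs.le, ← rpow_neg hs.le, neg_sub, mul_comm]
  have h := integral_posConvolution hf hg (ContinuousLinearMap.mul ℝ ℝ)
  simp only [ContinuousLinearMap.mul_apply'] at h
  rw [hG] at h
  rw [← h]
  refine integral_congr_ae (Filter.Eventually.of_forall fun t => ?_)
  dsimp only
  rw [← intervalIntegral.integral_const_mul]
  congr 1
  ext κ
  rw [show -(s * t) = -(s * κ) + -(s * (t - κ)) by ring, exp_add]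
  ring

/-- Aboodh transform of the Caputo fractional derivative of order `0 < β < 1`:
`A[D^β u](s) = s^β * A[u](s) - u 0 / s^(2-β)`, where `D^β u = J^{1-β} u'`. -/
theorem aboodh_caputo (u : ℝ → ℝ)
    (hu : ContDiffOn ℝ 1 u (Set.Ici 0))
    (M k : ℝ) (hM : 0 < M)
    (hbu : ∀ t : ℝ, 0 ≤ t → |u t| ≤ M * Real.exp (k * t))
    (hbu' : ∀ t : ℝ, 0 ≤ t → |derivWithin u (Set.Ici 0) t| ≤ M * Real.exp (k * t))
    (β : ℝ) (hβ0 : 0 < β) (hβ1 : β < 1) :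
    ∀ s : ℝ, max k 0 < s →
      (1 / s) * ∫ t in Set.Ioi (0 : ℝ),
          Real.exp (-(s * t)) *
            ((1 / Real.Gamma (1 - β)) *
              ∫ κ in (0 : ℝ)..t, (t - κ) ^ (-β) * derivWithin u (Set.Ici 0) κ) =
        s ^ β * ((1 / s) * ∫ t in Set.Ioi (0 : ℝ), u t * Real.exp (-(s * t))) -
          u 0 / s ^ (2 - β) := by
  intro s hs
  obtain ⟨hks, hs0⟩ := max_lt_iff.1 hs
  have hI' := integrableOn_mul_exp_of_abs_le
    (hu.continuousOn_derivWithin (uniqueDiffOn_Ici 0) le_rfl) hbu' hks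
  have hΓ : Gamma (1 - β) ≠ 0 := (Gamma_pos_of_pos (by linarith)).ne'
  simp_rw [mul_left_comm (exp _) (1 / Gamma (1 - β)), mul_comm (u _)]
  rw [MeasureTheory.integral_const_mul, integral_exp_mul_integral_sub_rpow_mul hβ1 hs0 hI',
    integral_exp_mul_derivWithin hu hbu hbu' hks, rpow_sub hs0, rpow_sub hs0, rpow_one, rpow_two]
  have hsβ : s ^ β ≠ 0 := (rpow_pos_of_pos hs0 β).ne'
  field_simp
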